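/- For any partition 𝒦 of N = {0,…,n} and any convex function f : Δ → ℝ on a nondegenerate simplex Δ ⊂ ℝⁿ with vertices x₀,…,xₙ, one has (n+1)·Avg(f, Δ) ≤ Σ_{K ∈ 𝒦} |K| · Avg(f, Δ_K) ≤ f(x₀)+⋯+f(xₙ). -/

import Mathlib

open MeasureTheory

/-- The average value of `f` over a set `S` with respect to `d`-dimensional
Hausdorff measure. -/
noncomputable def avgH {n : ℕ} (f : EuclideanSpace ℝ (Fin n) → ℝ) (d : ℝ)
    (S : Set (EuclideanSpace ℝ (Fin n))) : ℝ :=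
  ⨍ y in S, f y ∂(μH[d])

/-- `P` is a partition of `{0, …, m-1}` into pairwise disjoint nonempty subsets. -/
def IsPartition {m : ℕ} (P : Finset (Finset (Fin m))) : Prop :=
  (∀ K ∈ P, K.Nonempty) ∧ (P : Set (Finset (Fin m))).PairwiseDisjoint id ∧
    P.sup id = Finset.univ

open ProbabilityTheory Set Module
open scoped ENNReal

/-- The law of a family of independent standard exponential variables indexed by `ι`. -/
noncomputable def expPi (ι : Type*) [Fintype ι] : Measure (ι → ℝ) :=
  Measure.pi fun _ => expMeasure 1

/-- The point with homogeneous barycentric coordinates `t` with respect to `x`. -/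
noncomputable def baryPoint {ι E : Type*} [Fintype ι] [AddCommGroup E] [Module ℝ E]
    (x : ι → E) (t : ι → ℝ) : E :=
  (∑ i, t i)⁻¹ • ∑ i, t i • x i

instance : IsProbabilityMeasure (expMeasure 1) := isProbabilityMeasure_expMeasure one_pos

section ExpPi

variable {ι : Type*} [Fintype ι]

instance : IsProbabilityMeasure (expPi ι) := by unfold expPi; infer_instance

theorem pi_withDensity_ofReal {g : ℝ → ℝ} (hg0 : 0 ≤ g) (hg : Integrable g) :
    Measure.pi (fun _ : ι => volume.withDensity fun s => ENNReal.ofReal (g s)) =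
      volume.withDensity fun t : ι → ℝ => ∏ i, ENNReal.ofReal (g (t i)) := by
  have : IsFiniteMeasure (volume.withDensity fun s => ENNReal.ofReal (g s)) :=
    isFiniteMeasure_withDensity_ofReal hg.2
  refine Measure.pi_eq fun s hs => ?_
  have hbox : ∀ t : ι → ℝ, (univ.pi s).indicator (fun t => ∏ i, ENNReal.ofReal (g (t i))) t =
      ENNReal.ofReal (∏ i, (s i).indicator g (t i)) := by
    intro t
    rw [ENNReal.ofReal_prod_of_nonneg fun i _ => indicator_nonneg (fun a _ => hg0 a) _]
    by_cases ht : t ∈ univ.pi s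
    · rw [indicator_of_mem ht]
      exact Finset.prod_congr rfl fun i _ => by rw [indicator_of_mem (ht i trivial)]
    · rw [indicator_of_notMem ht]
      simp only [mem_pi, mem_univ, true_imp_iff, not_forall] at ht
      obtain ⟨i, hi⟩ := ht
      exact (Finset.prod_eq_zero (Finset.mem_univ i) (by simp [hi])).symm
  have hint : Integrable fun t : ι → ℝ => ∏ i, (s i).indicator g (t i) :=
    Integrable.fintype_prod fun i => hg.indicator (hs i)
  rw [withDensity_apply _ (MeasurableSet.univ_pi hs), ← lintegral_indicator (.univ_pi hs),
    lintegral_congr hbox, ← ofReal_integral_eq_lintegral_ofReal hint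
      (.of_forall fun t => Finset.prod_nonneg fun i _ => indicator_nonneg (fun a _ => hg0 a) _),
    integral_fintype_prod_volume_eq_prod,
    ENNReal.ofReal_prod_of_nonneg fun i _ =>
      integral_nonneg fun a => indicator_nonneg (fun a _ => hg0 a) a]
  refine Finset.prod_congr rfl fun i _ => ?_
  rw [withDensity_apply _ (hs i), integral_indicator (hs i),
    ofReal_integral_eq_lintegral_ofReal hg.restrict (.of_forall hg0)]

theorem integrable_exponentialPDFReal : Integrable (exponentialPDFReal 1) := by
  refine ⟨(measurable_exponentialPDFReal 1).aestronglyMeasurable, ?_⟩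
  rw [hasFiniteIntegral_iff_ofReal (.of_forall fun a => exponentialPDFReal_nonneg one_pos a)]
  have := lintegral_exponentialPDF_eq_one one_pos
  simp only [exponentialPDF] at this
  simp [this]

theorem measurable_exponentialPDF : Measurable (exponentialPDF 1) :=
  (measurable_exponentialPDFReal 1).ennreal_ofReal

theorem expPi_eq_withDensity :
    expPi ι = volume.withDensity fun t : ι → ℝ => ∏ i, exponentialPDF 1 (t i) :=
  pi_withDensity_ofReal (fun a => exponentialPDFReal_nonneg one_pos a)
    integrable_exponentialPDFReal

theorem prod_exponentialPDF_of_nonneg {t : ι → ℝ} (ht : 0 ≤ t) :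
    ∏ i, exponentialPDF 1 (t i) = ENNReal.ofReal (Real.exp (-∑ i, t i)) := by
  rw [← Finset.sum_neg_distrib, Real.exp_sum,
    ENNReal.ofReal_prod_of_nonneg fun i _ => (Real.exp_pos _).le]
  exact Finset.prod_congr rfl fun i _ => by rw [exponentialPDF_of_nonneg (ht i)]; simp

theorem prod_exponentialPDF_of_not_nonneg {t : ι → ℝ} (ht : ¬0 ≤ t) :
    ∏ i, exponentialPDF 1 (t i) = 0 := by
  simp only [Pi.le_def, not_forall, not_le] at ht
  obtain ⟨i, hi⟩ := ht
  exact Finset.prod_eq_zero (Finset.mem_univ i) (exponentialPDF_of_neg hi)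

theorem ae_pos_expMeasure : ∀ᵐ s ∂expMeasure 1, 0 < s := by
  have h : expMeasure 1 = volume.withDensity (exponentialPDF 1) := rfl
  rw [h, ae_withDensity_iff measurable_exponentialPDF]
  filter_upwards [Measure.ae_ne volume (0 : ℝ)] with s hs h
  exact lt_of_le_of_ne (not_lt.1 fun hneg => h (exponentialPDF_of_neg hneg)) hs.symm

theorem ae_pos_expPi : ∀ᵐ t ∂expPi ι, ∀ i, 0 < t i :=
  ae_all_iff.2 fun i =>
    (measurePreserving_eval (fun _ : ι => expMeasure 1) i).quasiMeasurePreserving.ae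
    ae_pos_expMeasure

theorem lintegral_ofReal_expMeasure : ∫⁻ s, ENNReal.ofReal s ∂expMeasure 1 = 1 := by
  have h : expMeasure 1 = volume.withDensity (exponentialPDF 1) := rfl
  rw [h, lintegral_withDensity_eq_lintegral_mul _ measurable_exponentialPDF
    ENNReal.measurable_ofReal, ← lintegral_gammaPDF_eq_one two_pos (one_pos (α := ℝ))]
  refine lintegral_congr fun s => ?_
  rcases le_or_gt 0 s with hs | hs
  · rw [Pi.mul_apply, exponentialPDF_of_nonneg hs, gammaPDF_of_nonneg hs,
      ← ENNReal.ofReal_mul (by positivity)]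
    congr 1
    norm_num [Real.Gamma_two]
    ring
  · rw [Pi.mul_apply, exponentialPDF_of_neg hs, gammaPDF_of_neg hs, zero_mul]

theorem integrable_eval_expPi (i : ι) : Integrable (fun t : ι → ℝ => t i) (expPi ι) := by
  refine integrable_eval (μ := fun _ : ι => expMeasure 1) ⟨aestronglyMeasurable_id, ?_⟩
  rw [hasFiniteIntegral_iff_ofReal (f := id) (ae_pos_expMeasure.mono fun s hs => hs.le)]
  simp [lintegral_ofReal_expMeasure]

theorem integral_eval_expPi (i : ι) : ∫ t, t i ∂expPi ι = 1 := by
  rw [expPi, integral_eval, integral_eq_lintegral_of_nonneg_ae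
    (ae_pos_expMeasure.mono fun s hs => hs.le) aestronglyMeasurable_id]
  simp [lintegral_ofReal_expMeasure]

theorem lintegral_ofReal_sum_expPi :
    ∫⁻ t, ENNReal.ofReal (∑ i, t i) ∂expPi ι = Fintype.card ι := by
  rw [← ofReal_integral_eq_lintegral_ofReal
      (integrable_finsetSum _ fun i _ => integrable_eval_expPi i)
      (ae_pos_expPi.mono fun t ht => Finset.sum_nonneg fun i _ => (ht i).le),
    integral_finsetSum _ fun i _ => integrable_eval_expPi i]
  simp [integral_eval_expPi]

theorem measurePreserving_restrict_expPi (K : Finset ι) :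
    MeasurePreserving (fun (t : ι → ℝ) (i : K) => t i) (expPi ι) (expPi K) := by
  classical
  convert measurePreserving_fst.comp
    (measurePreserving_piEquivPiSubtypeProd (fun _ : ι => expMeasure 1) (· ∈ K))
  · rfl
  · rfl
  · unfold expPi
    congr!

end ExpPi

section Simplex

variable {ι E : Type*} [Fintype ι] [NormedAddCommGroup E] [NormedSpace ℝ E]

theorem exists_weights_of_mem_convexHull_range {x : ι → E} {y : E}
    (hy : y ∈ convexHull ℝ (range x)) :
    ∃ w : ι → ℝ, 0 ≤ w ∧ ∑ i, w i = 1 ∧ ∑ i, w i • x i = y := by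
  classical
  rw [convexHull_range_eq_exists_affineCombination] at hy
  obtain ⟨s, w, hw0, hw1, rfl⟩ := hy
  refine ⟨fun i => if i ∈ s then w i else 0, fun i => ?_, by simpa using hw1, ?_⟩
  · dsimp only
    split_ifs with h
    exacts [hw0 i h, le_rfl]
  · rw [Finset.affineCombination_eq_linear_combination _ _ _ hw1]
    simp

theorem baryPoint_mem_convexHull {x : ι → E} {t : ι → ℝ} (ht : 0 ≤ t) (hs : 0 < ∑ i, t i) :
    baryPoint x t ∈ convexHull ℝ (range x) := by
  refine mem_convexHull_of_exists_fintype (fun i => (∑ j, t j)⁻¹ * t i) x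
    (fun i => mul_nonneg (inv_nonneg.2 hs.le) (ht i)) ?_ (fun i => mem_range_self i) ?_
  · rw [← Finset.mul_sum, inv_mul_cancel₀ hs.ne']
  · simp only [baryPoint, Finset.smul_sum, smul_smul]

/-- Homogeneous barycentric coordinates `t` with respect to an affinely independent family are
determined by `∑ i, t i • (x i - x i₀)` together with the total weight `∑ i, t i`. -/
theorem injective_linearCombination_vsub {x : ι → E} (hx : AffineIndependent ℝ x) (i₀ : ι) :
    Function.Injective (Fintype.linearCombination ℝ fun i =>
      ((⟨x i - x i₀, vsub_mem_vectorSpan ℝ (mem_range_self i) (mem_range_self i₀)⟩ :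
        vectorSpan ℝ (range x)), (1 : ℝ))) := by
  rw [injective_iff_map_eq_zero]
  intro t ht
  rw [Fintype.linearCombination_apply, Prod.ext_iff, Prod.fst_sum, Prod.snd_sum] at ht
  obtain ⟨h1, h2⟩ := ht
  have h2' : ∑ i, t i = 0 := by simpa using h2
  have h1' : ∑ i, t i • x i = 0 := by
    have := congrArg (Subtype.val) h1
    simpa [smul_sub, Finset.sum_sub_distrib, ← Finset.sum_smul, h2'] using this
  funext i
  exact affineIndependent_iff.1 hx Finset.univ t h2' h1' i (Finset.mem_univ i)

theorem finrank_vectorSpan_eq_card_sub_one [Nonempty ι] {x : ι → E}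
    (hx : AffineIndependent ℝ x) :
    (finrank ℝ (vectorSpan ℝ (range x)) : ℝ) = Fintype.card ι - 1 := by
  rw [eq_sub_iff_add_eq]
  exact_mod_cast hx.finrank_vectorSpan_add_one

theorem convexHull_range_subset_range_add {ι : Type*} (x : ι → E) (i₀ : ι) :
    convexHull ℝ (range x) ⊆ range fun w : vectorSpan ℝ (range x) => x i₀ + (w : E) := by
  intro y hy
  refine ⟨⟨y - x i₀, ?_⟩, by simp⟩
  have h := convexHull_subset_affineSpan (range x) hy
  rw [← direction_affineSpan]
  exact AffineSubspace.vsub_mem_direction h (mem_affineSpan ℝ (mem_range_self i₀))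

theorem isometry_add_vectorSpan {ι : Type*} (x : ι → E) (i₀ : ι) :
    Isometry fun w : vectorSpan ℝ (range x) => x i₀ + (w : E) :=
  (isometry_add_left (x i₀)).comp isometry_subtype_coe

theorem ConvexOn.exists_abs_le_of_convexHull_range {x : ι → E} {f : E → ℝ}
    (hf : ConvexOn ℝ (convexHull ℝ (range x)) f) :
    ∃ M, ∀ y ∈ convexHull ℝ (range x), |f y| ≤ M := by
  set m : ℝ := (Fintype.card ι : ℝ)
  set M := ∑ i, |f (x i)|
  set b := m⁻¹ • ∑ i, x i
  have hxm : ∀ i, x i ∈ convexHull ℝ (range x) := fun i => subset_convexHull _ _ (mem_range_self i)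
  refine ⟨M + m * |f b|, fun y hy => ?_⟩
  obtain ⟨w, hw0, hw1, rfl⟩ := exists_weights_of_mem_convexHull_range hy
  have hne : Nonempty ι := by
    by_contra h
    rw [not_nonempty_iff] at h
    rw [Finset.univ_eq_empty, Finset.sum_empty] at hw1
    exact zero_ne_one hw1
  have hm : 0 < m := Nat.cast_pos.2 Fintype.card_pos
  have hw1' : ∀ i, w i ≤ 1 := fun i =>
    hw1 ▸ Finset.single_le_sum (fun j _ => hw0 j) (Finset.mem_univ i)
  have hupper : f (∑ i, w i • x i) ≤ ∑ i, w i * f (x i) := by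
    simpa using hf.map_sum_le (fun i _ => hw0 i) hw1 fun i _ => hxm i
  have hlower : f b ≤ m⁻¹ * f (∑ i, w i • x i) + ∑ i, (m⁻¹ * (1 - w i)) * f (x i) := by
    have h := hf.map_sum_le (t := Finset.univ)
      (w := fun o : Option ι => o.elim m⁻¹ fun i => m⁻¹ * (1 - w i))
      (p := fun o : Option ι => o.elim (∑ i, w i • x i) x) ?_ ?_ ?_
    · simp only [Fintype.sum_option, Option.elim_none, Option.elim_some, smul_eq_mul] at h
      have hb : m⁻¹ • ∑ i, w i • x i + ∑ i, (m⁻¹ * (1 - w i)) • x i = b := by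
        simp only [b, mul_smul, ← Finset.smul_sum, ← smul_add, sub_smul, one_smul,
          Finset.sum_sub_distrib, add_sub_cancel]
      rwa [hb] at h
    · rintro (_ | i) -
      · exact inv_nonneg.2 hm.le
      · exact mul_nonneg (inv_nonneg.2 hm.le) (sub_nonneg.2 (hw1' i))
    · simp only [Fintype.sum_option, Option.elim_none, Option.elim_some, ← Finset.mul_sum,
        Finset.sum_sub_distrib, hw1]
      simp only [Finset.sum_const, Finset.card_univ, nsmul_eq_mul, mul_one]
      change m⁻¹ + m⁻¹ * (m - 1) = 1
      field_simp
      ring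
    · rintro (_ | i) -
      exacts [hy, hxm i]
  have hsum : ∀ u : ι → ℝ, (∀ i, 0 ≤ u i) → (∀ i, u i ≤ 1) → ∑ i, u i * f (x i) ≤ M := by
    refine fun u hu0 hu1 => Finset.sum_le_sum fun i _ => ?_
    calc u i * f (x i) ≤ u i * |f (x i)| := mul_le_mul_of_nonneg_left (le_abs_self _) (hu0 i)
      _ ≤ |f (x i)| := mul_le_of_le_one_left (abs_nonneg _) (hu1 i)
  have h1 := hsum w hw0 hw1'
  have h2 := hsum (fun i => 1 - w i) (fun i => sub_nonneg.2 (hw1' i))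
    (fun i => sub_le_self _ (hw0 i))
  have h3 : m * f b ≤ f (∑ i, w i • x i) + ∑ i, (1 - w i) * f (x i) := by
    have := mul_le_mul_of_nonneg_left hlower hm.le
    simp only [mul_assoc, ← Finset.mul_sum, ← mul_add] at this
    rwa [← mul_assoc m m⁻¹, mul_inv_cancel₀ hm.ne', one_mul] at this
  have h4 : -(m * |f b|) ≤ m * f b := by
    rw [← mul_neg]; exact mul_le_mul_of_nonneg_left (neg_abs_le _) hm.le
  have h5 : 0 ≤ m * |f b| := by positivity
  rw [abs_le]
  constructor <;> linarith

theorem ConvexOn.sum_mul_baryPoint_le {s : Set E} {f : E → ℝ} (hf : ConvexOn ℝ s f) {x : ι → E}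
    (hxs : ∀ i, x i ∈ s) {t : ι → ℝ} (ht : 0 ≤ t) (hs : 0 < ∑ i, t i) :
    (∑ i, t i) * f (baryPoint x t) ≤ ∑ i, t i * f (x i) := by
  have h := hf.map_centerMass_le (t := Finset.univ) (fun i _ => ht i) hs fun i _ => hxs i
  simp only [Finset.centerMass, smul_eq_mul, Function.comp_apply] at h
  rwa [← div_eq_inv_mul, le_div_iff₀' hs] at h

variable [MeasurableSpace E] [BorelSpace E]

theorem measurableSet_convexHull_range (x : ι → E) : MeasurableSet (convexHull ℝ (range x)) :=
  (finite_range x).isCompact_convexHull (𝕜 := ℝ) |>.isClosed.measurableSet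

theorem ConvexOn.aestronglyMeasurable_hausdorffMeasure [Nonempty ι] {x : ι → E}
    (hx : AffineIndependent ℝ x) {f : E → ℝ} (hf : ConvexOn ℝ (convexHull ℝ (range x)) f) :
    AEStronglyMeasurable f
      ((μH[(Fintype.card ι : ℝ) - 1]).restrict (convexHull ℝ (range x))) := by
  obtain ⟨i₀⟩ := ‹Nonempty ι›
  have : Nonempty ι := ⟨i₀⟩
  set V := vectorSpan ℝ (range x)
  set φ : V → E := fun w => x i₀ + (w : E)
  have hφ : Isometry φ := isometry_add_vectorSpan x i₀
  set C : Set V := φ ⁻¹' convexHull ℝ (range x) with hC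
  have hΔ := measurableSet_convexHull_range x
  have hg : ConvexOn ℝ C (f ∘ φ) := by
    exact (hf.translate_right (x i₀)).comp_linearMap V.subtype
  have hmeas : AEStronglyMeasurable (f ∘ φ) ((μH[(finrank ℝ V : ℝ)]).restrict C) := by
    rw [← Measure.restrict_congr_set
      (interior_ae_eq_of_null_frontier (hg.1.addHaar_frontier _))]
    exact hg.continuousOn_interior.aestronglyMeasurable isOpen_interior.measurableSet
  have hmap : ((μH[(finrank ℝ V : ℝ)] : Measure V).restrict C).map φ =
      (μH[(Fintype.card ι : ℝ) - 1]).restrict (convexHull ℝ (range x)) := by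
    rw [hC, ← Measure.restrict_map hφ.continuous.measurable hΔ,
      hφ.map_hausdorffMeasure (Or.inl (Nat.cast_nonneg _)), Measure.restrict_restrict hΔ,
      inter_eq_left.2 (convexHull_range_subset_range_add x i₀),
      finrank_vectorSpan_eq_card_sub_one hx]
  rw [← hmap, hφ.isClosedEmbedding.measurableEmbedding.aestronglyMeasurable_map_iff]
  exact hmeas

variable [FiniteDimensional ℝ E]

theorem exists_map_baryPoint_eq_smul_hausdorffMeasure [Nonempty ι] {x : ι → E}
    (hx : AffineIndependent ℝ x) :
    ∃ c : ℝ≥0∞, ((expPi ι).withDensity fun t => ENNReal.ofReal (∑ i, t i)).map (baryPoint x) =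
      c • (μH[(Fintype.card ι : ℝ) - 1]).restrict (convexHull ℝ (range x)) := by
  obtain ⟨i₀⟩ := ‹Nonempty ι›
  have : Nonempty ι := ⟨i₀⟩
  set V := vectorSpan ℝ (range x)
  set μ : Measure V := μH[(finrank ℝ V : ℝ)] with hμ
  have : μ.IsAddHaarMeasure := by rw [hμ]; infer_instance
  set L₀ := Fintype.linearCombination ℝ fun i =>
      ((⟨x i - x i₀, vsub_mem_vectorSpan ℝ (mem_range_self i) (mem_range_self i₀)⟩ : V), (1 : ℝ))
    with hL₀
  have hinj : Function.Injective L₀ := injective_linearCombination_vsub hx i₀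
  have hdim : finrank ℝ (ι → ℝ) = finrank ℝ (V × ℝ) := by
    rw [finrank_prod, finrank_self, finrank_fintype_fun_eq_card, hx.finrank_vectorSpan_add_one]
  set L : (ι → ℝ) ≃L[ℝ] V × ℝ := (L₀.linearEquivOfInjective hinj hdim).toContinuousLinearEquiv
  have hLa : ∀ t, L t = L₀ t := fun t => rfl
  have hL2 : ∀ t, (L t).2 = ∑ i, t i := fun t => by
    rw [hLa, hL₀, Fintype.linearCombination_apply, Prod.snd_sum]; simp
  have hL1 : ∀ t, ((L t).1 : E) = ∑ i, t i • x i - (∑ i, t i) • x i₀ := fun t => by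
    rw [hLa, hL₀, Fintype.linearCombination_apply, Prod.fst_sum]
    simp [smul_sub, Finset.sum_sub_distrib, Finset.sum_smul]
  have hbary : ∀ t, 0 < ∑ i, t i → baryPoint x t = x i₀ + (((L t).2⁻¹ • (L t).1 : V) : E) := by
    intro t ht
    rw [Submodule.coe_smul, hL1, hL2, smul_sub, smul_smul, inv_mul_cancel₀ ht.ne', one_smul,
      baryPoint]
    abel
  have hnonneg : ∀ t, 0 < ∑ i, t i → baryPoint x t ∈ convexHull ℝ (range x) → 0 ≤ t := by
    intro t ht hmem
    obtain ⟨w, hw0, hw1, hw⟩ := exists_weights_of_mem_convexHull_range hmem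
    have hsw : ∑ i, ((∑ j, t j) • w) i = ∑ i, t i := by
      simp [← Finset.mul_sum, hw1]
    have : t = (∑ j, t j) • w := by
      apply L.injective
      refine Prod.ext (Subtype.ext ?_) ?_
      · rw [hL1, hL1, hsw]
        simp only [Pi.smul_apply, smul_assoc, ← Finset.smul_sum, hw]
        rw [baryPoint, smul_smul, mul_inv_cancel₀ ht.ne', one_smul]
      · rw [hL2, hL2, hsw]
    rw [this]
    exact smul_nonneg ht.le hw0
  set c₀ := Measure.addHaarScalarFactor (volume.map L) (μ.prod volume)
  have hc₀ : volume.map L = c₀ • μ.prod (volume : Measure ℝ) :=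
    Measure.isAddLeftInvariant_eq_smul _ _
  have hΔ := measurableSet_convexHull_range x
  have hbm : Measurable (baryPoint x) := by unfold baryPoint; fun_prop
  have hφ : Isometry fun w : V => x i₀ + (w : E) := isometry_add_vectorSpan x i₀
  refine ⟨c₀ * ∫⁻ s : ℝ, ENNReal.ofReal (Real.exp (-s) * s) *
    ENNReal.ofReal |((s⁻¹) ^ finrank ℝ V)⁻¹|, ?_⟩
  ext A hA
  set B : Set V := (fun w : V => x i₀ + (w : E)) ⁻¹' (A ∩ convexHull ℝ (range x)) with hB
  have hBm : MeasurableSet B := (hA.inter hΔ).preimage hφ.continuous.measurable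
  set G : V × ℝ → ℝ≥0∞ := fun p => ENNReal.ofReal (Real.exp (-p.2) * p.2) *
    B.indicator 1 (p.2⁻¹ • p.1) with hG
  have hGm : Measurable G := by
    refine Measurable.mul (by fun_prop) ((measurable_one.indicator hBm).comp (by fun_prop))
  have hpt : ∀ t : ι → ℝ, (∏ i, exponentialPDF 1 (t i)) *
      (baryPoint x ⁻¹' A).indicator (fun t => ENNReal.ofReal (∑ i, t i)) t = G (L t) := by
    intro t
    simp only [hG, hL2]
    rcases le_or_gt (∑ i, t i) 0 with hs | hs
    · rw [ENNReal.ofReal_of_nonpos (mul_nonpos_of_nonneg_of_nonpos (Real.exp_pos _).le hs),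
        zero_mul]
      simp [indicator, ENNReal.ofReal_of_nonpos hs]
    · have hmem : (∑ i, t i)⁻¹ • (L t).1 ∈ B ↔
          baryPoint x t ∈ A ∧ baryPoint x t ∈ convexHull ℝ (range x) := by
        rw [hbary t hs, hL2]; rfl
      by_cases ht : 0 ≤ t
      · rw [prod_exponentialPDF_of_nonneg ht, ENNReal.ofReal_mul (Real.exp_pos _).le, mul_assoc]
        have hb := baryPoint_mem_convexHull (x := x) ht hs
        by_cases hbA : baryPoint x t ∈ A
        · rw [indicator_of_mem (hmem.2 ⟨hbA, hb⟩), indicator_of_mem (by exact hbA)]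
          simp
        · rw [indicator_of_notMem (fun h => hbA (hmem.1 h).1), indicator_of_notMem (by exact hbA),
            mul_zero, mul_zero, mul_zero]
      · rw [prod_exponentialPDF_of_not_nonneg ht, zero_mul,
          indicator_of_notMem (fun h => ht (hnonneg t hs (hmem.1 h).2)), mul_zero]
  have hinner : ∀ s : ℝ, ∫⁻ v, G (v, s) ∂μ = ENNReal.ofReal (Real.exp (-s) * s) *
      ENNReal.ofReal |((s⁻¹) ^ finrank ℝ V)⁻¹| * μ B := by
    intro s
    rcases le_or_gt s 0 with hs | hs
    · simp [hG, ENNReal.ofReal_of_nonpos (mul_nonpos_of_nonneg_of_nonpos (Real.exp_pos _).le hs)]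
    · simp only [hG]
      rw [lintegral_const_mul' _ _ ENNReal.ofReal_ne_top, mul_assoc]
      congr 1
      have : ∀ v : V, B.indicator (1 : V → ℝ≥0∞) (s⁻¹ • v) =
          ((s⁻¹ • ·) ⁻¹' B).indicator 1 v := fun v => rfl
      rw [lintegral_congr this, lintegral_indicator_one (hBm.preimage (by fun_prop)),
        Measure.addHaar_preimage_smul μ (inv_ne_zero hs.ne')]
  have hμB : μ B = (μH[(Fintype.card ι : ℝ) - 1] : Measure E) (A ∩ convexHull ℝ (range x)) := by
    rw [hμ, hB, hφ.hausdorffMeasure_preimage (Or.inl (Nat.cast_nonneg _)),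
      finrank_vectorSpan_eq_card_sub_one hx, inter_eq_left.2]
    exact inter_subset_right.trans (convexHull_range_subset_range_add x i₀)
  have hρ : Measurable fun t : ι → ℝ => ∏ i, exponentialPDF 1 (t i) :=
    Finset.measurable_prod _ fun i _ => measurable_exponentialPDF.comp (measurable_pi_apply i)
  rw [Measure.map_apply hbm hA, withDensity_apply _ (hA.preimage hbm),
    ← lintegral_indicator (hA.preimage hbm), expPi_eq_withDensity,
    lintegral_withDensity_eq_lintegral_mul _ hρ
      ((by fun_prop : Measurable fun t : ι → ℝ => ENNReal.ofReal (∑ i, t i)).indicator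
        (hA.preimage hbm))]
  simp only [Pi.mul_apply]
  rw [lintegral_congr hpt, ← lintegral_map hGm L.continuous.measurable, hc₀,
    lintegral_smul_measure, lintegral_prod_symm _ hGm.aemeasurable, lintegral_congr hinner,
    lintegral_mul_const _ (by fun_prop), hμB, Measure.smul_apply, Measure.restrict_apply hA,
    smul_eq_mul, mul_assoc]
  rfl

theorem ConvexOn.integrable_and_integral_sum_mul_baryPoint [Nonempty ι] {x : ι → E}
    (hx : AffineIndependent ℝ x) {f : E → ℝ} (hf : ConvexOn ℝ (convexHull ℝ (range x)) f) :
    Integrable (fun t => (∑ i, t i) * f (baryPoint x t)) (expPi ι) ∧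
      ∫ t, (∑ i, t i) * f (baryPoint x t) ∂expPi ι =
        Fintype.card ι * ⨍ y in convexHull ℝ (range x), f y ∂μH[(Fintype.card ι : ℝ) - 1] := by
  obtain ⟨c, hc⟩ := exists_map_baryPoint_eq_smul_hausdorffMeasure hx
  obtain ⟨M, hM⟩ := hf.exists_abs_le_of_convexHull_range
  have hΔ := measurableSet_convexHull_range x
  have hbm : Measurable (baryPoint x) := by unfold baryPoint; fun_prop
  have hSm : Measurable fun t : ι → ℝ => ENNReal.ofReal (∑ i, t i) := by fun_prop
  set Q := (expPi ι).withDensity fun t => ENNReal.ofReal (∑ i, t i)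
  set H := (μH[(Fintype.card ι : ℝ) - 1] : Measure E)
  have hmass : c * H (convexHull ℝ (range x)) = Fintype.card ι := by
    have h := congrArg (fun ν => ν univ) hc
    simp only [Measure.map_apply hbm MeasurableSet.univ, preimage_univ, Measure.smul_apply,
      Measure.restrict_apply MeasurableSet.univ, univ_inter, smul_eq_mul] at h
    rw [← h, withDensity_apply _ MeasurableSet.univ, Measure.restrict_univ,
      lintegral_ofReal_sum_expPi]
  have hcard : (Fintype.card ι : ℝ≥0∞) ≠ 0 := by exact_mod_cast Fintype.card_ne_zero
  have hH0 : H (convexHull ℝ (range x)) ≠ 0 := fun h => hcard (by rw [← hmass, h, mul_zero])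
  have hc0 : c ≠ 0 := fun h => hcard (by rw [← hmass, h, zero_mul])
  have htop : c * H (convexHull ℝ (range x)) ≠ ∞ := hmass ▸ ENNReal.natCast_ne_top _
  have hHtop : H (convexHull ℝ (range x)) ≠ ∞ := fun h => htop (by rw [h, ENNReal.mul_top hc0])
  have hctop : c ≠ ∞ := fun h => htop (by rw [h, ENNReal.top_mul hH0])
  have hfH : IntegrableOn f (convexHull ℝ (range x)) H :=
    .of_bound hHtop.lt_top (hf.aestronglyMeasurable_hausdorffMeasure hx) M
      ((ae_restrict_iff' hΔ).2 (.of_forall hM))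
  have hfQ : Integrable f (Q.map (baryPoint x)) := hc ▸ hfH.smul_measure hctop
  have hfbQ : Integrable (f ∘ baryPoint x) Q := hfQ.comp_measurable hbm
  have hS : ∀ᵐ t ∂expPi ι, (ENNReal.ofReal (∑ i, t i)).toReal • f (baryPoint x t) =
      (∑ i, t i) * f (baryPoint x t) := ae_pos_expPi.mono fun t ht => by
    rw [ENNReal.toReal_ofReal (Finset.sum_nonneg fun i _ => (ht i).le), smul_eq_mul]
  constructor
  · refine Integrable.congr ?_ hS
    exact (integrable_withDensity_iff_integrable_smul' hSm
      (.of_forall fun t => ENNReal.ofReal_lt_top)).1 hfbQ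
  · have hreal : c.toReal * H.real (convexHull ℝ (range x)) = Fintype.card ι := by
      rw [Measure.real, ← ENNReal.toReal_mul, hmass, ENNReal.toReal_natCast]
    have hr0 : H.real (convexHull ℝ (range x)) ≠ 0 := ENNReal.toReal_ne_zero.2 ⟨hH0, hHtop⟩
    rw [← integral_congr_ae hS, ← integral_withDensity_eq_integral_toReal_smul hSm
      (.of_forall fun t => ENNReal.ofReal_lt_top) (fun t => f (baryPoint x t)),
      ← integral_map hbm.aemeasurable hfQ.1, hc, integral_smul_measure, setAverage_eq,
      smul_eq_mul, smul_eq_mul, ← hreal, mul_assoc, mul_inv_cancel_left₀ hr0]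

end Simplex

section Partition

variable {n : ℕ}

/-- The perspective function of `f` at the part of `t` supported on `K`. -/
noncomputable def facePerspective (x : Fin (n + 1) → EuclideanSpace ℝ (Fin n))
    (f : EuclideanSpace ℝ (Fin n) → ℝ) (K : Finset (Fin (n + 1))) (t : Fin (n + 1) → ℝ) : ℝ :=
  (∑ i : K, t i) * f (baryPoint (fun i : K => x i) fun i : K => t i)

variable {x : Fin (n + 1) → EuclideanSpace ℝ (Fin n)} {f : EuclideanSpace ℝ (Fin n) → ℝ}

theorem integrable_and_integral_facePerspective (hx : AffineIndependent ℝ x)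
    (hf : ConvexOn ℝ (convexHull ℝ (range x)) f) {K : Finset (Fin (n + 1))} (hK : K.Nonempty) :
    Integrable (facePerspective x f K) (expPi (Fin (n + 1))) ∧
      ∫ t, facePerspective x f K t ∂expPi (Fin (n + 1)) =
        K.card * avgH f ((K.card : ℝ) - 1) (convexHull ℝ (x '' ↑K)) := by
  have : Nonempty K := hK.to_subtype
  have hrange : range (fun i : K => x i) = x '' ↑K := by
    rw [image_eq_range]; rfl
  have hfK : ConvexOn ℝ (convexHull ℝ (range fun i : K => x i)) f :=
    hf.subset (convexHull_mono (range_comp_subset_range _ x)) (convex_convexHull ℝ _)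
  obtain ⟨hint, heq⟩ := hfK.integrable_and_integral_sum_mul_baryPoint
    (x := fun i : K => x i) (hx.comp_embedding (Function.Embedding.subtype (· ∈ K)))
  have hmp := measurePreserving_restrict_expPi K
  refine ⟨hmp.integrable_comp_of_integrable hint, ?_⟩
  rw [hrange, Fintype.card_coe] at heq
  rw [avgH, ← heq, ← hmp.map_eq, integral_map hmp.measurable.aemeasurable
    (hmp.map_eq.symm ▸ hint.1)]
  rfl

theorem facePerspective_le (hf : ConvexOn ℝ (convexHull ℝ (range x)) f)
    {K : Finset (Fin (n + 1))} (hK : K.Nonempty) {t : Fin (n + 1) → ℝ} (ht : ∀ i, 0 < t i) :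
    facePerspective x f K t ≤ ∑ i ∈ K, t i * f (x i) := by
  rw [← Finset.sum_coe_sort K fun i => t i * f (x i)]
  have : Nonempty K := hK.to_subtype
  exact hf.sum_mul_baryPoint_le (ι := K) (x := fun i : K => x i) (t := fun i : K => t i)
    (fun i => subset_convexHull _ _ (mem_range_self i.1)) (fun i => (ht i).le)
    (Finset.sum_pos (fun i _ => ht i) Finset.univ_nonempty)

theorem IsPartition.sum_sum {M : Type*} [AddCommMonoid M] {m : ℕ} {P : Finset (Finset (Fin m))}
    (hP : IsPartition P) (g : Fin m → M) : ∑ K ∈ P, ∑ i ∈ K, g i = ∑ i, g i := by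
  rw [← hP.2.2, Finset.sup_eq_biUnion, Finset.sum_biUnion hP.2.1]
  rfl

theorem sum_mul_baryPoint_le_sum_facePerspective
    (hf : ConvexOn ℝ (convexHull ℝ (range x)) f) {P : Finset (Finset (Fin (n + 1)))}
    (hP : IsPartition P) {t : Fin (n + 1) → ℝ} (ht : ∀ i, 0 < t i) :
    (∑ i, t i) * f (baryPoint x t) ≤ ∑ K ∈ P, facePerspective x f K t := by
  have hpos : ∀ K : P, 0 < ∑ i : (K : Finset (Fin (n + 1))), t i := fun K => by
    have : Nonempty (K : Finset (Fin (n + 1))) := (hP.1 K K.2).to_subtype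
    exact Finset.sum_pos (fun i _ => ht i) Finset.univ_nonempty
  have hsum : ∑ K : P, ∑ i : (K : Finset (Fin (n + 1))), t i = ∑ i, t i := by
    rw [← hP.sum_sum, ← Finset.sum_coe_sort P fun K => _]
    exact Finset.sum_congr rfl fun K _ => Finset.sum_coe_sort (K : Finset (Fin (n + 1))) t
  have hsum_smul : ∑ K : P, ∑ i : (K : Finset (Fin (n + 1))), t i • x i = ∑ i, t i • x i := by
    rw [← hP.sum_sum, ← Finset.sum_coe_sort P fun K => _]
    exact Finset.sum_congr rfl fun K _ =>
      Finset.sum_coe_sort (K : Finset (Fin (n + 1))) fun i => t i • x i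
  have hS : 0 < ∑ i, t i := Finset.sum_pos (fun i _ => ht i) Finset.univ_nonempty
  have h := hf.sum_mul_baryPoint_le (ι := P)
    (x := fun K => baryPoint (fun i : (K : Finset (Fin (n + 1))) => x i) fun i => t i)
    (t := fun K => ∑ i : (K : Finset (Fin (n + 1))), t i)
    (fun K => convexHull_mono (range_comp_subset_range _ x)
      (baryPoint_mem_convexHull (fun i => (ht i).le) (hpos K)))
    (fun K => (hpos K).le) (hsum ▸ hS)
  have hbary : baryPoint (fun K : P => baryPoint (fun i : (K : Finset (Fin (n + 1))) => x i)
      fun i => t i) (fun K : P => ∑ i : (K : Finset (Fin (n + 1))), t i) = baryPoint x t := by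
    unfold baryPoint
    rw [hsum, ← hsum_smul]
    congr 1
    refine Finset.sum_congr rfl fun K _ => ?_
    rw [smul_smul, mul_inv_cancel₀ (hpos K).ne', one_smul]
  rw [hsum, hbary] at h
  rw [← Finset.sum_coe_sort P fun K => facePerspective x f K t]
  exact h

end Partition

theorem avg_le_F_le_sum (n : ℕ) (x : Fin (n + 1) → EuclideanSpace ℝ (Fin n))
    (hx : AffineIndependent ℝ x) (f : EuclideanSpace ℝ (Fin n) → ℝ)
    (hf : ConvexOn ℝ (convexHull ℝ (Set.range x)) f)
    (𝒦 : Finset (Finset (Fin (n + 1)))) (h𝒦 : IsPartition 𝒦) :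
    ((n : ℝ) + 1) * avgH f (n : ℝ) (convexHull ℝ (Set.range x)) ≤
        (∑ K ∈ 𝒦, (K.card : ℝ) * avgH f ((K.card : ℝ) - 1) (convexHull ℝ (x '' ↑K))) ∧
      (∑ K ∈ 𝒦, (K.card : ℝ) * avgH f ((K.card : ℝ) - 1) (convexHull ℝ (x '' ↑K))) ≤
        ∑ i, f (x i) := by
  have hface := fun K hK => integrable_and_integral_facePerspective hx hf (h𝒦.1 K hK)
  obtain ⟨hint, heq⟩ := hf.integrable_and_integral_sum_mul_baryPoint hx
  have hint_sum : Integrable (fun t => ∑ K ∈ 𝒦, facePerspective x f K t) (expPi (Fin (n + 1))) :=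
    integrable_finsetSum _ fun K hK => (hface K hK).1
  have hsum : ∑ K ∈ 𝒦, (K.card : ℝ) * avgH f ((K.card : ℝ) - 1) (convexHull ℝ (x '' ↑K)) =
      ∫ t, ∑ K ∈ 𝒦, facePerspective x f K t ∂expPi (Fin (n + 1)) := by
    rw [integral_finsetSum _ fun K hK => (hface K hK).1]
    exact Finset.sum_congr rfl fun K hK => (hface K hK).2.symm
  have hvert : ∑ i, f (x i) = ∫ t, ∑ i, t i * f (x i) ∂expPi (Fin (n + 1)) := by
    rw [integral_finsetSum _ fun i _ => (integrable_eval_expPi i).mul_const _]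
    simp [integral_mul_const, integral_eval_expPi]
  rw [hsum]
  constructor
  · have hcard : ((n : ℝ) + 1) * avgH f (n : ℝ) (convexHull ℝ (Set.range x)) =
        ∫ t, (∑ i, t i) * f (baryPoint x t) ∂expPi (Fin (n + 1)) := by
      rw [heq, avgH, Fintype.card_fin]
      push_cast
      rw [add_sub_cancel_right]
    rw [hcard]
    exact integral_mono_ae hint hint_sum
      (ae_pos_expPi.mono fun t ht => sum_mul_baryPoint_le_sum_facePerspective hf h𝒦 ht)
  · rw [hvert]
    refine integral_mono_ae hint_sum
      (integrable_finsetSum _ fun i _ => (integrable_eval_expPi i).mul_const _)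
      (ae_pos_expPi.mono fun t ht => ?_)
    calc ∑ K ∈ 𝒦, facePerspective x f K t ≤ ∑ K ∈ 𝒦, ∑ i ∈ K, t i * f (x i) :=
          Finset.sum_le_sum fun K hK => facePerspective_le hf (h𝒦.1 K hK) ht
      _ = ∑ i, t i * f (x i) := h𝒦.sum_sum _
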